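/- For every integer g ≥ 1, the continued-fraction value of the list [2, 2] followed by the pair (−2, 2) repeated g−1 times equals 2g/(6g−1); that is, CF([2, 2, −2, 2, −2, 2, …, −2, 2]) = 2g/(6g−1) in ℚ, where the list has 2g entries and every entry is ±2. -/

import Mathlib

/-- Continued-fraction value of a list: `CF [n₁, …, n_t] = 1/(n₁ + 1/(n₂ + ⋯ + 1/n_t))`. -/
def CF (l : List ℚ) : ℚ := l.foldr (fun n x => (n + x)⁻¹) 0

theorem CF_cons (a : ℚ) (l : List ℚ) : CF (a :: l) = (a + CF l)⁻¹ := rfl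

theorem inv_two_add_neg_div (n : ℕ) :
    ((2 : ℚ) + -(2 * n) / (2 * n + 1))⁻¹ = (2 * n + 1) / (2 * n + 2) := by
  have h : (2 * n + 1 : ℚ) ≠ 0 := by positivity
  rw [← inv_div (2 * (n : ℚ) + 2)]
  congr 1
  field_simp
  ring

theorem CF_flatten_replicate_neg_two_two (n : ℕ) :
    CF (List.flatten (List.replicate n [(-2 : ℚ), 2])) = -(2 * n) / (2 * n + 1) := by
  induction n with
  | zero => simp [CF]
  | succ n ih =>
    rw [List.replicate_succ, List.flatten_cons, List.cons_append, List.cons_append,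
      List.nil_append, CF_cons, CF_cons, ih, inv_two_add_neg_div]
    have h : (2 * n + 2 : ℚ) ≠ 0 := by positivity
    have e : (-2 + (2 * n + 1) / (2 * n + 2) : ℚ) = -(2 * n + 3) / (2 * n + 2) := by
      field_simp
      ring
    rw [e, inv_div, div_neg, neg_div]
    push_cast
    ring_nf

/-- For every integer `g ≥ 1`, the continued-fraction value of `[2, 2]` followed by the
pair `(−2, 2)` repeated `g − 1` times is `2g/(6g−1)`. -/
theorem cf_fiber_expansion (g : ℕ) (hg : 1 ≤ g) :
    CF ([(2 : ℚ), 2] ++ List.flatten (List.replicate (g - 1) [(-2 : ℚ), 2])) =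
      (2 * g) / (6 * g - 1) := by
  obtain ⟨n, rfl⟩ := Nat.exists_eq_add_of_le' hg
  rw [Nat.add_sub_cancel, List.cons_append, List.cons_append, List.nil_append, CF_cons, CF_cons,
    CF_flatten_replicate_neg_two_two, inv_two_add_neg_div]
  have h : (2 * n + 2 : ℚ) ≠ 0 := by positivity
  have e : (2 + (2 * n + 1) / (2 * n + 2) : ℚ) = (6 * n + 5) / (2 * n + 2) := by
    field_simp
    ring
  rw [e, inv_div]
  push_cast
  ring_nf
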